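/- arXiv:2005.12139 — 2 statements merged into one kernel-verified Lean document; each statement's English description precedes it below -/
import Mathlib

section
/- Let K be a perfect field of characteristic different from 2, let t ≥ 2, and let a_1, …, a_t ∈ K^× be units with a_1 + a_2 + ⋯ + a_t = 1. Then the product of symbols [a_1][a_2]⋯[a_t] equals 0 in the Milnor-Witt K-theory K^MW_*(K). -/
/-!
Milnor-Witt K-theory of a field `K`, presented as the quotient of the free
(associative, unital) `ℤ`-algebra on generators `[a]` (for `a ∈ Kˣ`, degree 1)
and `η` (degree `-1`) by the Milnor-Witt relations.
-/

namespace MWStatement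

variable (K : Type) [Field K]

/-- The free `ℤ`-algebra on the generators of Milnor-Witt K-theory:
`none` stands for `η` and `some a` for the symbol `[a]`, `a ∈ Kˣ`. -/
abbrev Pre := FreeAlgebra ℤ (Option Kˣ)

/-- The generator `η`. -/
noncomputable def preEta : Pre K := FreeAlgebra.ι ℤ (none : Option Kˣ)

/-- The symbol `[a]` for a unit `a`. -/
noncomputable def preSym (a : Kˣ) : Pre K := FreeAlgebra.ι ℤ (some a)

/-- The defining relations of Milnor-Witt K-theory. -/
inductive Rel : Pre K → Pre K → Prop
  | steinberg (a : Kˣ) (h : (a : K) ≠ 1) :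
      Rel (preSym K a * preSym K (Units.mk0 (1 - (a : K)) (sub_ne_zero_of_ne (Ne.symm h)))) 0
  | mulSym (a b : Kˣ) :
      Rel (preSym K (a * b)) (preSym K a + preSym K b + preEta K * preSym K a * preSym K b)
  | etaComm (a : Kˣ) : Rel (preEta K * preSym K a) (preSym K a * preEta K)
  | hyperbolic : Rel (preEta K * ((2 : Pre K) + preEta K * preSym K (-1))) 0

/-- Milnor-Witt K-theory `K^MW_*(K)` (as a ring, forgetting the grading). -/
abbrev KMW := RingQuot (Rel K)

/-- The class of `η` in Milnor-Witt K-theory. -/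
noncomputable def eta : KMW K := RingQuot.mkRingHom (Rel K) (preEta K)

/-- The class of the symbol `[a]` in Milnor-Witt K-theory. -/
noncomputable def sym (a : Kˣ) : KMW K := RingQuot.mkRingHom (Rel K) (preSym K a)

end MWStatement

namespace MWStatement

variable {K : Type} [Field K]

theorem sym_mul_sym_of_add_eq_one {a b : Kˣ} (h : (a : K) + b = 1) : sym K a * sym K b = 0 := by
  have ha : (a : K) ≠ 1 := fun ha => b.ne_zero (by simp [ha] at h)
  have hb : b = Units.mk0 (1 - (a : K)) (sub_ne_zero_of_ne ha.symm) :=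
    Units.ext (by simp [← h])
  have := RingQuot.mkRingHom_rel (Rel.steinberg a ha)
  rw [map_mul, map_zero, ← hb] at this
  exact this

theorem sym_mul (a b : Kˣ) :
    sym K (a * b) = sym K a + sym K b + eta K * sym K a * sym K b := by
  have h := RingQuot.mkRingHom_rel (Rel.mulSym a b)
  simp only [map_add, map_mul] at h
  exact h

theorem eta_mul_sym (a : Kˣ) : eta K * sym K a = sym K a * eta K := by
  have h := RingQuot.mkRingHom_rel (Rel.etaComm a)
  simp only [map_mul] at h
  exact h

theorem eta_mul_hyperbolic : eta K * (2 + eta K * sym K (-1)) = 0 := by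
  have h := RingQuot.mkRingHom_rel (Rel.hyperbolic (K := K))
  simp only [map_add, map_mul, map_ofNat, map_zero] at h
  exact h

theorem eta_mul_sym_mul_sym_comm (a b : Kˣ) :
    eta K * sym K a * sym K b = eta K * sym K b * sym K a := by
  have h := sym_mul a b
  rw [mul_comm, sym_mul b a, add_comm (sym K b)] at h
  exact (add_left_cancel h).symm

@[simp]
theorem sym_one : sym K 1 = 0 := by
  have h : eta K * sym K 1 = 0 := by
    have h1 := sym_mul (-1 : Kˣ) (-1)
    rw [neg_mul_neg, one_mul] at h1
    calc eta K * sym K 1 = eta K * (2 + eta K * sym K (-1)) * sym K (-1) := by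
          rw [h1]; noncomm_ring
      _ = 0 := by rw [eta_mul_hyperbolic, zero_mul]
  simpa [h] using sym_mul (1 : Kˣ) 1

theorem one_add_eta_sym_mul_inv (a : Kˣ) :
    (1 + eta K * sym K a) * (1 + eta K * sym K a⁻¹) = 1 := by
  have h := sym_mul a a⁻¹
  rw [mul_inv_cancel, sym_one] at h
  calc (1 + eta K * sym K a) * (1 + eta K * sym K a⁻¹)
      = 1 + eta K * sym K a + eta K * sym K a⁻¹ + eta K * (sym K a * eta K) * sym K a⁻¹ := by
        noncomm_ring
    _ = 1 + eta K * (sym K a + sym K a⁻¹ + eta K * sym K a * sym K a⁻¹) := by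
        rw [← eta_mul_sym]; noncomm_ring
    _ = 1 := by rw [← h, mul_zero, add_zero]

theorem sym_mul_sym_neg (a : Kˣ) : sym K a * sym K (-a) = 0 := by
  by_cases ha : (a : K) = 1
  · rw [Units.val_eq_one.mp ha, sym_one, zero_mul]
  obtain ⟨w, hw⟩ : ∃ w : Kˣ, (w : K) = 1 - (a : K)⁻¹ :=
    ⟨Units.mk0 (1 - (a : K)⁻¹) (sub_ne_zero_of_ne fun h => ha (by simpa using h.symm)), rfl⟩
  have h1 : sym K a * sym K (-a * w) = 0 :=
    sym_mul_sym_of_add_eq_one (by push_cast; rw [hw]; field_simp; ring)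
  have h2 : sym K a⁻¹ * sym K w = 0 :=
    sym_mul_sym_of_add_eq_one (by rw [hw]; push_cast; ring)
  have h3 : sym K a * sym K w = 0 := by
    have h := sym_mul a a⁻¹
    rw [mul_inv_cancel, sym_one] at h
    calc sym K a * sym K w
        = (sym K a + sym K a⁻¹ + eta K * sym K a * sym K a⁻¹) * sym K w
          - (1 + eta K * sym K a) * (sym K a⁻¹ * sym K w) := by noncomm_ring
      _ = 0 := by rw [← h, h2, zero_mul, mul_zero, sub_zero]
  have h4 : sym K a * sym K (-a) * (1 + eta K * sym K w) = 0 := by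
    rw [← h1, sym_mul, mul_add, mul_add, mul_add, h3, eta_mul_sym (-a), mul_assoc (sym K (-a)),
      eta_mul_sym w]
    noncomm_ring
  rw [← mul_one (sym K a * sym K (-a)), ← one_add_eta_sym_mul_inv w, ← mul_assoc, h4, zero_mul]

theorem exists_eq_mul_of_add_mul_eq_zero {R : Type*} [Ring R] {p y b : R} (h : p + y * b = 0) :
    ∃ x, p = x * b :=
  ⟨-y, by rw [neg_mul, eq_neg_of_add_eq_zero_left h]⟩

/-- A weak form of graded commutativity, sufficient to move a symbol to the right. -/
theorem exists_sym_mul_sym_eq_mul_sym (a b : Kˣ) : ∃ x, sym K b * sym K a = x * sym K b := by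
  have h := sym_mul_sym_neg (-a * b)
  rw [neg_mul, neg_neg, ← neg_mul, sym_mul, sym_mul] at h
  have h1 : sym K (-a) * sym K a = 0 := by simpa using sym_mul_sym_neg (-a)
  have h2 : sym K (-a) * eta K * sym K b * sym K a = 0 := by
    rw [mul_assoc (sym K (-a)), mul_assoc (sym K (-a)), eta_mul_sym_mul_sym_comm b a, eta_mul_sym,
      ← mul_assoc, ← mul_assoc, h1, zero_mul, zero_mul]
  rw [eta_mul_sym (-a), eta_mul_sym a] at h
  set x := sym K (-a)
  refine exists_eq_mul_of_add_mul_eq_zero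
    (y := x + sym K b + sym K b * sym K a * eta K + x * eta K * sym K b) ?_
  calc sym K b * sym K a
        + (x + sym K b + sym K b * sym K a * eta K + x * eta K * sym K b) * sym K b
      = (x + sym K b + x * eta K * sym K b) * (sym K a + sym K b + sym K a * eta K * sym K b)
        - x * sym K a * (1 + eta K * sym K b)
        - x * eta K * sym K b * sym K a * (1 + eta K * sym K b) := by noncomm_ring
    _ = 0 := by rw [h, h1, h2]; simp

/-- If `a + b = s ≠ 0`, then `[a][b]` is a left multiple of `[s]`. -/
theorem exists_sym_mul_sym_eq_mul_sym_add {a b s : Kˣ} (h : (a : K) + b = s) :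
    ∃ x, sym K a * sym K b = x * sym K s := by
  have h1 : sym K (a * s⁻¹) * sym K (b * s⁻¹) = 0 :=
    sym_mul_sym_of_add_eq_one (by push_cast; rw [← add_mul, h]; simp)
  obtain ⟨x, hx⟩ := exists_sym_mul_sym_eq_mul_sym (b * s⁻¹) s
  have ha := sym_mul (a * s⁻¹) s
  have hb := sym_mul (b * s⁻¹) s
  rw [inv_mul_cancel_right] at ha hb
  set u := sym K (a * s⁻¹)
  set v := sym K (b * s⁻¹)
  refine ⟨(u + sym K s + eta K * u * sym K s) * (1 + eta K * v) + (1 + eta K * u) * x, ?_⟩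
  calc sym K a * sym K b
      = u * v + (u + sym K s + eta K * u * sym K s) * (1 + eta K * v) * sym K s
        + (1 + eta K * u) * (sym K s * v) := by rw [ha, hb]; noncomm_ring
    _ = _ := by rw [h1, hx]; noncomm_ring

theorem sym_mul_sym_mul_prod_eq_zero (l : List Kˣ) (a b : Kˣ)
    (h : (a : K) + b + (l.map Units.val).sum = 1) :
    sym K a * sym K b * (l.map (sym K)).prod = 0 := by
  induction l generalizing a b with
  | nil => rw [sym_mul_sym_of_add_eq_one (by simpa using h), zero_mul]
  | cons c l ih =>
    by_cases hs : (a : K) + b = 0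
    · rw [show b = -a from Units.ext (by simpa using (neg_eq_of_add_eq_zero_right hs).symm),
        sym_mul_sym_neg, zero_mul]
    · obtain ⟨x, hx⟩ := exists_sym_mul_sym_eq_mul_sym_add (a := a) (b := b)
        (s := Units.mk0 _ hs) rfl
      rw [hx, List.map_cons, List.prod_cons, mul_assoc, ← mul_assoc (sym K _),
        ih _ c (by simpa [add_assoc] using h), mul_zero]

end MWStatement

open MWStatement in
/-- Let `K` be a perfect field of characteristic `≠ 2`, `t ≥ 2`, and
`a 1, …, a t ∈ Kˣ` units with `a 1 + ⋯ + a t = 1`.  Then `[a 1] ⋯ [a t] = 0` in `K^MW_*(K)`. -/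
theorem statement0 (K : Type) [Field K] [PerfectField K] (hchar : (2 : K) ≠ 0)
    (t : ℕ) (ht : 2 ≤ t) (a : Fin t → Kˣ) (hsum : ∑ i, (a i : K) = 1) :
    (List.ofFn fun i => sym K (a i)).prod = 0 := by
  obtain ⟨n, rfl⟩ := Nat.exists_eq_add_of_le' ht
  have h := sym_mul_sym_mul_prod_eq_zero (List.ofFn fun i : Fin n => a i.succ.succ) (a 0) (a 1)
    (by simpa [List.map_ofFn, List.sum_ofFn, Fin.sum_univ_succ, add_assoc] using hsum)
  simpa [List.map_ofFn, List.ofFn_succ, Function.comp_def, mul_assoc] using h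
end

section
/- Let K be a perfect field of characteristic different from 2, let t ≥ 1, and let f_0, …, f_t ∈ K^× be units with f_0 + f_1 + ⋯ + f_t = 0. Then R(f_0, …, f_t) = 0 in the Milnor-Witt K-theory K^MW_*(K). -/
/-!
Milnor-Witt K-theory of a field `K`, presented as the quotient of the free
(associative, unital) `ℤ`-algebra on generators `[a]` (for `a ∈ Kˣ`, degree 1)
and `η` (degree `-1`) by the Milnor-Witt relations.
-/

namespace MWStatement

variable (K : Type) [Field K]

/-- `⟨a⟩ = 1 + η [a]`. -/
noncomputable def gw (a : Kˣ) : KMW K := 1 + eta K * sym K a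

/-- `ε = -⟨-1⟩ = -(1 + η [-1])`. -/
noncomputable def eps : KMW K := -(gw K (-1))

/-- The ordered product `[f j₁] ⋯ [f jₘ]` over the indices `j ∉ s`, taken in
increasing order of indices. -/
noncomputable def prodOmit {t : ℕ} (f : Fin t → Kˣ) (s : Finset (Fin t)) : KMW K :=
  (((List.finRange t).filter fun j => decide (j ∉ s)).map fun j => sym K (f j)).prod

/-- The element `R(f 0, …, f t)`, namely
`Σ_{i=0}^{t} ε^{t+i} [f 0]⋯\widehat{[f i]}⋯[f t] +
 Σ_{k=1}^{t} Σ_{0 ≤ i₀ < ⋯ < i_k ≤ t} (−1)^k [−1]^k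
   [f 0]⋯\widehat{[f i₀]}⋯\widehat{[f i_k]}⋯[f t]`,
where hats denote omitted factors (the second sum is indexed by the subsets
`s = {i₀ < ⋯ < i_k}` of cardinality `k + 1 ≥ 2` of omitted indices). -/
noncomputable def Rsym {t : ℕ} (f : Fin (t + 1) → Kˣ) : KMW K :=
  (∑ i : Fin (t + 1), eps K ^ (t + (i : ℕ)) * prodOmit K f {i}) +
    ∑ s ∈ Finset.univ.powerset.filter (fun s : Finset (Fin (t + 1)) => 2 ≤ s.card),
      (-1 : KMW K) ^ (s.card - 1) * sym K (-1) ^ (s.card - 1) * prodOmit K f s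

end MWStatement

lemma sum_finset_fin_succ {n : ℕ} {M : Type*} [AddCommMonoid M] (F : Finset (Fin (n + 1)) → M) :
    ∑ s, F s = ∑ s : Finset (Fin n), F (s.map (Fin.succEmb n)) +
      ∑ s : Finset (Fin n), F (insert 0 (s.map (Fin.succEmb n))) := by
  have h0 : (0 : Fin (n + 1)) ∉ (Finset.univ : Finset (Fin n)).map (Fin.succEmb n) := by simp
  have hu : (Finset.univ : Finset (Fin (n + 1))) =
      insert 0 ((Finset.univ : Finset (Fin n)).map (Fin.succEmb n)) := by
    rw [Fin.univ_succ, Finset.cons_eq_insert]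
    rfl
  have hp : ((Finset.univ : Finset (Fin n)).map (Fin.succEmb n)).powerset =
      (Finset.univ : Finset (Finset (Fin n))).map
        (Finset.mapEmbedding (Fin.succEmb n)).toEmbedding := by
    ext s
    simp [Finset.subset_map_iff, eq_comm]
  rw [← Finset.powerset_univ, hu, Finset.sum_powerset_insert h0, hp, Finset.sum_map, Finset.sum_map]
  simp

/-- A ring `A` with elements `η` and `[a]`, `a ∈ Kˣ`, satisfying the Milnor-Witt relations. -/
structure MWSymbols (K A : Type*) [Field K] [Ring A] where
  /-- The element `η`. -/
  eta : A
  /-- The symbol `[a]`. -/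
  sym : Kˣ → A
  steinberg (a b : Kˣ) : (a : K) + b = 1 → sym a * sym b = 0
  sym_mul (a b : Kˣ) : sym (a * b) = sym a + sym b + eta * sym a * sym b
  eta_mul_sym (a : Kˣ) : eta * sym a = sym a * eta
  eta_mul_hyperbolic : eta * (2 + eta * sym (-1)) = 0

namespace MWSymbols

variable {K A : Type*} [Field K] [Ring A] (S : MWSymbols K A)

/-- `⟨a⟩ = 1 + η [a]`. -/
def gw (a : Kˣ) : A := 1 + S.eta * S.sym a

/-- `ε = -⟨-1⟩`. -/
def eps : A := -S.gw (-1)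

/-- The ordered product of the symbols `[f j]` over the indices `j ∉ s`. -/
def prodOmit {t : ℕ} (f : Fin t → Kˣ) (s : Finset (Fin t)) : A :=
  (((List.finRange t).filter fun j => decide (j ∉ s)).map fun j => S.sym (f j)).prod

lemma eta_mul_sym_mul_sym (a b : Kˣ) :
    S.eta * S.sym a * S.sym b = S.eta * S.sym b * S.sym a := by
  have h := S.sym_mul a b
  rw [mul_comm a b, S.sym_mul, add_comm (S.sym b)] at h
  exact (add_left_cancel h).symm

lemma gw_commute_sym (a b : Kˣ) : Commute (S.gw a) (S.sym b) := by
  refine (Commute.one_left _).add_left ?_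
  rw [commute_iff_eq, S.eta_mul_sym_mul_sym, S.eta_mul_sym b, mul_assoc]

lemma sym_mul_eq_add_gw (a b : Kˣ) : S.sym (a * b) = S.sym a + S.gw a * S.sym b := by
  rw [S.sym_mul, gw]
  noncomm_ring

lemma sym_one : S.sym 1 = 0 := by
  have h₁ : S.eta * S.sym 1 = 0 := by
    have h : S.sym ((-1) * (-1)) = (2 + S.eta * S.sym (-1)) * S.sym (-1) := by
      rw [S.sym_mul]
      noncomm_ring
    rw [neg_mul_neg, one_mul] at h
    rw [h, ← mul_assoc, S.eta_mul_hyperbolic, zero_mul]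
  have h₂ := S.sym_mul 1 1
  rw [h₁, zero_mul, add_zero, mul_one] at h₂
  simpa using h₂

lemma gw_mul (a b : Kˣ) : S.gw a * S.gw b = S.gw (a * b) := by
  have h : S.eta * S.sym a * S.eta = S.eta * S.eta * S.sym a := by
    rw [mul_assoc, ← S.eta_mul_sym, mul_assoc]
  simp only [gw, S.sym_mul, mul_add, add_mul, mul_one, one_mul, ← mul_assoc, h]
  abel

lemma sym_inv (a : Kˣ) : S.sym a⁻¹ = -(S.gw a⁻¹ * S.sym a) := by
  rw [eq_neg_iff_add_eq_zero, ← S.sym_mul_eq_add_gw, inv_mul_cancel, S.sym_one]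

lemma sym_mul_sym_neg (a : Kˣ) : S.sym a * S.sym (-a) = 0 := by
  rcases eq_or_ne a 1 with rfl | ha
  · rw [S.sym_one, zero_mul]
  have ha' : (a : K) ≠ 1 := by simpa using ha
  have ha0 := a.ne_zero
  let b : Kˣ := Units.mk0 (1 - (a : K)) (sub_ne_zero_of_ne ha'.symm)
  let c : Kˣ := Units.mk0 (1 - (a : K)⁻¹)
    (sub_ne_zero_of_ne fun h => ha' (inv_eq_one.mp h.symm))
  have hab : S.sym a * S.sym b = 0 := S.steinberg a b (by simp [b])
  have hac : S.sym a⁻¹ * S.sym c = 0 := S.steinberg a⁻¹ c (by simp [c])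
  have hac' : S.sym a * S.sym c = 0 := by
    rw [← inv_inv a, S.sym_inv, neg_mul, mul_assoc, hac, mul_zero, neg_zero]
  have hbc : -a = b * c⁻¹ := by
    rw [eq_mul_inv_iff_mul_eq]
    ext
    simp only [b, c, Units.val_mul, Units.val_neg, Units.val_mk0]
    field_simp
    ring
  rw [hbc, S.sym_mul_eq_add_gw, S.sym_inv, mul_add, hab, zero_add, mul_neg, mul_neg, ← mul_assoc,
    ← mul_assoc, ← (S.gw_commute_sym b a).eq, mul_assoc (S.gw b), ← (S.gw_commute_sym c⁻¹ a).eq,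
    mul_assoc, mul_assoc, hac', mul_zero, mul_zero, neg_zero]

lemma sym_mul_self (a : Kˣ) : S.sym a * S.sym a = S.sym a * S.sym (-1) := by
  have h : S.sym a = S.sym (-1) + S.gw (-1) * S.sym (-a) := by
    rw [← S.sym_mul_eq_add_gw, neg_mul_neg, one_mul]
  calc S.sym a * S.sym a = S.sym a * (S.sym (-1) + S.gw (-1) * S.sym (-a)) := by rw [← h]
    _ = S.sym a * S.sym (-1) := by
      rw [mul_add, ← mul_assoc, ← (S.gw_commute_sym (-1) a).eq, mul_assoc, S.sym_mul_sym_neg,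
        mul_zero, add_zero]

lemma eta_mul_sym_neg_one_mul_sym (a : Kˣ) :
    S.eta * (S.eta * S.sym (-1)) * S.sym a = -(2 * (S.eta * S.sym a)) := by
  have h := congrArg (· * S.sym a) S.eta_mul_hyperbolic
  simp only [zero_mul, mul_add, add_mul] at h
  rw [eq_neg_iff_add_eq_zero, add_comm, ← h]
  noncomm_ring

lemma gw_mul_self (a : Kˣ) : S.gw a * S.gw a = 1 := by
  have h : S.eta * (S.sym a + S.sym a + S.eta * S.sym a * S.sym a) = 0 := by
    rw [mul_assoc S.eta (S.sym a), S.sym_mul_self, ← mul_assoc S.eta (S.sym a),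
      S.eta_mul_sym_mul_sym, mul_add, ← mul_assoc, ← mul_assoc, mul_assoc S.eta S.eta,
      S.eta_mul_sym_neg_one_mul_sym]
    noncomm_ring
  rw [S.gw_mul, gw, S.sym_mul, h, add_zero]

lemma sym_mul_comm (a b : Kˣ) : S.sym b * S.sym a = S.eps * (S.sym a * S.sym b) := by
  have h := S.sym_mul_sym_neg (a * b)
  have ha : S.sym (-(a * b)) = S.sym (-a) + S.gw (-a) * S.sym b := by
    rw [← S.sym_mul_eq_add_gw, neg_mul]
  have hb : S.sym (-(a * b)) = S.sym a + S.gw a * S.sym (-b) := by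
    rw [← S.sym_mul_eq_add_gw, mul_neg]
  have e₁ : S.sym a * S.sym (-(a * b)) = S.gw (-a) * (S.sym a * S.sym b) := by
    rw [ha, mul_add, S.sym_mul_sym_neg, zero_add, ← mul_assoc, ← (S.gw_commute_sym (-a) a).eq,
      mul_assoc]
  have e₂ : S.sym b * S.sym (-(a * b)) = S.sym b * S.sym a := by
    rw [hb, mul_add, ← mul_assoc, ← (S.gw_commute_sym a b).eq, mul_assoc, S.sym_mul_sym_neg,
      mul_zero, add_zero]
  rw [S.sym_mul_eq_add_gw, add_mul, mul_assoc, e₁, e₂] at h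
  have h' := congrArg (S.gw a * ·) h
  simp only [mul_add, mul_zero] at h'
  have e₃ : S.gw a * S.gw (-a) = S.gw (-1) := by
    have : -a = a * (-1) := by simp
    rw [this, ← S.gw_mul, ← mul_assoc, S.gw_mul_self, one_mul]
  rw [← mul_assoc, ← mul_assoc (S.gw a) (S.gw a), e₃, S.gw_mul_self, one_mul, add_comm] at h'
  rw [eq_neg_of_add_eq_zero_left h', eps, neg_mul]

lemma eps_commute_sym (a : Kˣ) : Commute S.eps (S.sym a) :=
  (S.gw_commute_sym (-1) a).neg_left

lemma eps_mul_self : S.eps * S.eps = 1 := by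
  rw [eps, neg_mul_neg, S.gw_mul_self]

lemma eps_mul_sym_neg_one : S.eps * S.sym (-1) = S.sym (-1) := by
  have h := S.sym_mul_eq_add_gw (-1) (-1)
  rw [neg_mul_neg, one_mul, S.sym_one] at h
  rw [eps, neg_mul, neg_eq_iff_add_eq_zero, add_comm, ← h]

lemma sym_neg_one_commute_sym (a : Kˣ) : Commute (S.sym (-1)) (S.sym a) := by
  rw [commute_iff_eq, S.sym_mul_comm, ← mul_assoc, (S.eps_commute_sym a).eq, mul_assoc,
    S.eps_mul_sym_neg_one]

lemma sym_neg (a : Kˣ) : S.sym (-a) = S.sym (-1) - S.eps * S.sym a := by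
  rw [← neg_one_mul a, S.sym_mul_eq_add_gw, eps]
  noncomm_ring

lemma sym_sub_mul_sym_sub (a b c : Kˣ) (h : (a : K) + b = c) :
    (S.sym a - S.sym c) * (S.sym b - S.sym c) = 0 := by
  have key (x : Kˣ) : S.sym x - S.sym c = S.gw c * S.sym (c⁻¹ * x) := by
    rw [sub_eq_iff_eq_add', ← S.sym_mul_eq_add_gw, mul_inv_cancel_left]
  have hst : S.sym (c⁻¹ * a) * S.sym (c⁻¹ * b) = 0 := by
    apply S.steinberg
    have := c.ne_zero
    simp [← mul_add, h]
  rw [key, key, mul_assoc, ← mul_assoc (S.sym _), ← (S.gw_commute_sym c (c⁻¹ * a)).eq,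
    mul_assoc (S.gw c) (S.sym _), hst, mul_zero, mul_zero]

lemma three_term (a b c : Kˣ) (h : (a : K) + b = c) :
    (S.sym a - S.sym (-1)) * (S.sym b - S.sym (-1)) =
      (S.sym a - S.sym (-1) + S.eps * S.sym b) * (S.sym c - S.sym (-1)) := by
  have h₁ := S.sym_sub_mul_sym_sub a b c h
  simp only [mul_sub, sub_mul, add_mul] at h₁ ⊢
  rw [S.sym_mul_self c, S.sym_mul_comm b c, ← (S.sym_neg_one_commute_sym c).eq] at h₁
  rw [(S.sym_neg_one_commute_sym b).eq, mul_assoc S.eps _ (S.sym (-1)),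
    ← (S.sym_neg_one_commute_sym b).eq, ← mul_assoc S.eps (S.sym (-1)), S.eps_mul_sym_neg_one,
    (S.sym_neg_one_commute_sym b).eq, mul_assoc, ← sub_eq_zero, ← h₁]
  abel

lemma two_term_mul (a : Kˣ) :
    (S.sym a - S.sym (-1)) * (S.sym (-a) - S.sym (-1)) = 0 := by
  rw [S.sym_neg a, sub_sub_cancel_left, mul_neg, ← mul_assoc, sub_mul, ← (S.eps_commute_sym a).eq,
    ← (S.eps_commute_sym (-1)).eq, ← mul_sub, mul_assoc, sub_mul, S.sym_mul_self,
    (S.sym_neg_one_commute_sym a).eq, sub_self, mul_zero, neg_zero]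

lemma two_term_add (a : Kˣ) : S.sym a - S.sym (-1) + S.eps * S.sym (-a) = 0 := by
  rw [S.sym_neg a, mul_sub, S.eps_mul_sym_neg_one, ← mul_assoc, S.eps_mul_self, one_mul]
  abel

lemma prodOmit_tail {n : ℕ} (f : Fin (n + 1) → Kˣ) (s : Finset (Fin n)) :
    S.prodOmit f (s.map (Fin.succEmb n)) = S.sym (f 0) * S.prodOmit (Fin.tail f) s := by
  simp [prodOmit, List.finRange_succ, List.filter_map, Function.comp_def, Fin.tail]

lemma prodOmit_insert_zero {n : ℕ} (f : Fin (n + 1) → Kˣ) (s : Finset (Fin n)) :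
    S.prodOmit f (insert 0 (s.map (Fin.succEmb n))) = S.prodOmit (Fin.tail f) s := by
  simp [prodOmit, List.finRange_succ, List.filter_map, Function.comp_def, Fin.tail]

/-- The part of `R` that omits exactly one factor, normalized by `ε`-powers `ε ^ i`. -/
def singleSum {n : ℕ} (f : Fin n → Kˣ) : A :=
  ∑ i : Fin n, S.eps ^ (i : ℕ) * S.prodOmit f {i}

/-- The part of `R` that omits at least two factors. -/
def multiSum {n : ℕ} (f : Fin n → Kˣ) : A :=
  ∑ s : Finset (Fin n), if 2 ≤ s.card then (-S.sym (-1)) ^ (s.card - 1) * S.prodOmit f s else 0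

/-- The element `R`, defined for families of any size. -/
def relSum {n : ℕ} (f : Fin n → Kˣ) : A :=
  S.eps ^ (n + 1) * S.singleSum f + S.multiSum f

lemma eps_pow_add_two (n : ℕ) : S.eps ^ (n + 2) = S.eps ^ n := by
  rw [pow_add, sq, S.eps_mul_self, mul_one]

/-- The element `R(f 0, …, f t)`. -/
def rsym {t : ℕ} (f : Fin (t + 1) → Kˣ) : A :=
  (∑ i : Fin (t + 1), S.eps ^ (t + (i : ℕ)) * S.prodOmit f {i}) +
    ∑ s ∈ Finset.univ.powerset.filter (fun s : Finset (Fin (t + 1)) => 2 ≤ s.card),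
      (-1 : A) ^ (s.card - 1) * S.sym (-1) ^ (s.card - 1) * S.prodOmit f s

lemma rsym_eq_relSum {t : ℕ} (f : Fin (t + 1) → Kˣ) : S.rsym f = S.relSum f := by
  rw [rsym, relSum, singleSum, multiSum, S.eps_pow_add_two, Finset.mul_sum, Finset.powerset_univ,
    Finset.sum_filter]
  congr 1
  · exact Finset.sum_congr rfl fun i _ => by rw [pow_add, mul_assoc]
  · refine Finset.sum_congr rfl fun s _ => ?_
    rw [neg_pow (S.sym (-1))]

lemma singleSum_succ {n : ℕ} (f : Fin (n + 1) → Kˣ) :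
    S.singleSum f = S.prodOmit (Fin.tail f) ∅ + S.eps * S.sym (f 0) * S.singleSum (Fin.tail f) := by
  have h0 : S.prodOmit f {0} = S.prodOmit (Fin.tail f) ∅ := by
    simpa using S.prodOmit_insert_zero f ∅
  have hs (i : Fin n) : S.prodOmit f {i.succ} = S.sym (f 0) * S.prodOmit (Fin.tail f) {i} := by
    simpa using S.prodOmit_tail f {i}
  rw [singleSum, Fin.sum_univ_succ, h0, singleSum, Finset.mul_sum]
  simp only [hs, Fin.val_zero, pow_zero, one_mul, Fin.val_succ]
  congr 1
  refine Finset.sum_congr rfl fun i _ => ?_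
  rw [← mul_assoc, ← mul_assoc, pow_succ', mul_assoc S.eps, mul_assoc S.eps,
    ((S.eps_commute_sym (f 0)).pow_left (i : ℕ)).eq, ← mul_assoc, ← mul_assoc]

lemma sym_neg_one_mul_eps_pow (n : ℕ) : S.sym (-1) * S.eps ^ n = S.sym (-1) := by
  rw [← ((S.eps_commute_sym (-1)).pow_left n).eq]
  induction n with
  | zero => simp
  | succ n ih => rw [pow_succ, mul_assoc, S.eps_mul_sym_neg_one, ih]

lemma multiSum_succ {n : ℕ} (f : Fin (n + 1) → Kˣ) :
    S.multiSum f = (S.sym (f 0) - S.sym (-1)) * S.multiSum (Fin.tail f) -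
      S.sym (-1) * S.singleSum (Fin.tail f) := by
  have hsingle : -(S.sym (-1) * S.singleSum (Fin.tail f)) =
      ∑ s : Finset (Fin n), if s.card = 1 then -S.sym (-1) * S.prodOmit (Fin.tail f) s else 0 := by
    rw [← Finset.sum_filter, ← Finset.powerset_univ, ← Finset.powersetCard_eq_filter,
      Finset.powersetCard_one, Finset.sum_map, singleSum, Finset.mul_sum, ← Finset.sum_neg_distrib]
    refine Finset.sum_congr rfl fun i _ => ?_
    rw [← mul_assoc, S.sym_neg_one_mul_eps_pow]
    simp
  have hcomm (m : ℕ) : (-S.sym (-1)) ^ m * S.sym (f 0) = S.sym (f 0) * (-S.sym (-1)) ^ m :=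
    ((S.sym_neg_one_commute_sym (f 0)).neg_left.pow_left m).eq
  rw [sub_mul, sub_sub, sub_eq_add_neg, neg_add, add_comm (-_) (-_), hsingle, ← neg_mul, multiSum,
    sum_finset_fin_succ, multiSum, Finset.mul_sum, Finset.mul_sum]
  congr 1
  · refine Finset.sum_congr rfl fun s _ => ?_
    rw [Finset.card_map, S.prodOmit_tail, mul_ite, mul_zero, ← mul_assoc, ← mul_assoc, hcomm]
  · rw [← Finset.sum_add_distrib]
    refine Finset.sum_congr rfl fun s _ => ?_
    rw [Finset.card_insert_of_notMem (by simp), Finset.card_map, S.prodOmit_insert_zero]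
    rcases s.card with _ | _ | m
    · simp
    · simp
    · simp [pow_succ', mul_assoc]

lemma relSum_succ {n : ℕ} (f : Fin (n + 1) → Kˣ) :
    S.relSum f = (S.sym (f 0) - S.sym (-1)) * S.relSum (Fin.tail f) +
      S.eps ^ n * S.prodOmit (Fin.tail f) ∅ := by
  have h : S.eps ^ n * (S.eps * S.sym (f 0)) = S.sym (f 0) * S.eps ^ (n + 1) := by
    rw [← mul_assoc, ← pow_succ, ((S.eps_commute_sym (f 0)).pow_left (n + 1)).eq]
  rw [relSum, relSum, S.eps_pow_add_two, S.singleSum_succ, S.multiSum_succ, mul_add, mul_add,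
    sub_mul, sub_mul, ← mul_assoc, h, ← mul_assoc (S.sym (-1)), S.sym_neg_one_mul_eps_pow]
  noncomm_ring

lemma relSum_succ_succ {n : ℕ} (f : Fin (n + 2) → Kˣ) :
    S.relSum f =
      (S.sym (f 0) - S.sym (-1)) * (S.sym (f 1) - S.sym (-1)) * S.relSum (Fin.tail (Fin.tail f)) +
      (S.sym (f 0) - S.sym (-1) + S.eps * S.sym (f 1)) *
        (S.eps ^ n * S.prodOmit (Fin.tail (Fin.tail f)) ∅) := by
  have h : S.eps ^ (n + 1) * S.sym (f 1) = S.eps * S.sym (f 1) * S.eps ^ n := by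
    rw [pow_succ', mul_assoc, mul_assoc, ((S.eps_commute_sym (f 1)).pow_left n).eq]
  have hp : S.prodOmit (Fin.tail f) ∅ = S.sym (f 1) * S.prodOmit (Fin.tail (Fin.tail f)) ∅ := by
    simpa [Fin.tail] using S.prodOmit_tail (Fin.tail f) ∅
  have h1 : Fin.tail f 0 = f 1 := rfl
  rw [S.relSum_succ, S.relSum_succ (Fin.tail f), hp, ← mul_assoc (S.eps ^ (n + 1)), h, h1]
  noncomm_ring

theorem relSum_eq_zero {n : ℕ} (f : Fin (n + 2) → Kˣ) (hf : ∑ i, (f i : K) = 0) :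
    S.relSum f = 0 := by
  induction n with
  | zero =>
    have h1 : f 1 = -f 0 := by
      ext
      rw [Fin.sum_univ_two] at hf
      rw [Units.val_neg]
      linear_combination hf
    rw [S.relSum_succ_succ, h1, S.two_term_mul, S.two_term_add, zero_mul, zero_mul, add_zero]
  | succ n ih =>
    by_cases hg : (f 0 : K) + f 1 = 0
    · have h1 : f 1 = -f 0 := by
        ext
        rw [Units.val_neg]
        linear_combination hg
      rw [S.relSum_succ_succ, h1, S.two_term_mul, S.two_term_add, zero_mul, zero_mul, add_zero]
    · let g : Kˣ := Units.mk0 _ hg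
      have hR := ih (Fin.cons g (Fin.tail (Fin.tail f))) (by
        rw [Fin.sum_univ_succ, Fin.sum_univ_succ] at hf
        rw [Fin.sum_univ_succ, ← hf, ← add_assoc]
        rfl)
      rw [S.relSum_succ, Fin.tail_cons, Fin.cons_zero] at hR
      rw [S.relSum_succ_succ, S.three_term _ _ g rfl, mul_assoc, ← mul_add, hR, mul_zero]

end MWSymbols

namespace MWStatement

/-- The tautological symbols in Milnor-Witt K-theory. -/
noncomputable def symbols (K : Type) [Field K] : MWSymbols K (KMW K) where
  eta := eta K
  sym := sym K
  steinberg a b h := by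
    have ha : (a : K) ≠ 1 := fun ha => b.ne_zero (by simp [ha] at h)
    have hb : b = Units.mk0 (1 - (a : K)) (sub_ne_zero_of_ne (Ne.symm ha)) := by
      ext
      simp [← h]
    rw [hb]
    simpa [sym] using RingQuot.mkRingHom_rel (Rel.steinberg a ha)
  sym_mul a b := by
    simpa [sym, eta] using RingQuot.mkRingHom_rel (Rel.mulSym a b)
  eta_mul_sym a := by
    simpa [sym, eta] using RingQuot.mkRingHom_rel (Rel.etaComm a)
  eta_mul_hyperbolic := by
    have h := RingQuot.mkRingHom_rel (Rel.hyperbolic (K := K))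
    rw [map_mul, map_add, map_mul, map_zero, map_ofNat] at h
    exact h

end MWStatement

open MWStatement in
/-- Let `K` be a perfect field of characteristic `≠ 2`, `t ≥ 1`, and
`f 0, …, f t ∈ Kˣ` units with `f 0 + f 1 + ⋯ + f t = 0`.  Then `R(f 0, …, f t) = 0`
in the Milnor-Witt K-theory `K^MW_*(K)`. -/
theorem statement1 (K : Type) [Field K] [PerfectField K] (hchar : (2 : K) ≠ 0)
    (t : ℕ) (ht : 1 ≤ t) (f : Fin (t + 1) → Kˣ) (hsum : ∑ i, (f i : K) = 0) :
    Rsym K f = 0 := by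
  obtain ⟨n, rfl⟩ := Nat.exists_eq_add_of_le' ht
  exact ((symbols K).rsym_eq_relSum f).trans ((symbols K).relSum_eq_zero f hsum)
end
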